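/- arXiv:1102.5691 — 5 statements merged into one kernel-verified Lean document; each statement's English description precedes it below -/
import Mathlib

section
/- Let F ≥ 0 and let g_i : ℝ → [0,∞), i ∈ ℤ, be nonnegative locally bounded functions. Let u_i : [0,∞) → ℝ, i ∈ ℤ, be differentiable functions with u_i(0) = 0 solving du_i/dt = ( u_{i−1}(t) + u_{i+1}(t) − 2u_i(t) − g_i(u_i(t)) + F )⁺ for all t ≥ 0. Then for every i ∈ ℤ and every t ≥ 0, H_i(t) := u_{i−1}(t) + u_{i+1}(t) − 2u_i(t) + F ≥ 0. -/
/-- A function on `[0, ∞)` that starts nonnegative and whose derivative is nonnegative wherever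
the function is negative stays nonnegative. -/
theorem nonneg_of_deriv_nonneg_of_neg {f f' : ℝ → ℝ} (h0 : 0 ≤ f 0)
    (hf : ∀ t, 0 ≤ t → HasDerivWithinAt f (f' t) (Set.Ici 0) t)
    (hf' : ∀ t, 0 ≤ t → f t < 0 → 0 ≤ f' t) {t : ℝ} (ht : 0 ≤ t) : 0 ≤ f t := by
  have key : ∀ ε > 0, -f t ≤ ε * (1 + t) := by
    intro ε hε
    refine image_le_of_deriv_right_lt_deriv_boundary (f := fun x => -f x) (f' := fun x => -f' x)
      (B := fun x => ε * (1 + x)) (B' := fun _ => ε) (a := 0) (b := t)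
      ?_ ?_ ?_ ?_ ?_ (Set.right_mem_Icc.2 ht)
    · exact fun x hx => ((hf x hx.1).continuousWithinAt.mono fun y hy => hy.1).neg
    · exact fun x hx => ((hf x hx.1).mono (Set.Ici_subset_Ici.2 hx.1)).neg
    · linarith
    · exact fun x => by simpa using ((hasDerivAt_id x).const_add 1).const_mul ε
    · intro x hx hxB
      have hpos : 0 < ε * (1 + x) := mul_pos hε (by linarith [hx.1])
      linarith [hf' x hx.1 (by linarith)]
  refine neg_nonpos.1 (le_of_forall_pos_le_add fun δ hδ => ?_)
  have h := key (δ / (1 + t)) (by positivity)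
  rw [div_mul_cancel₀ δ (by positivity)] at h
  linarith

/-- for the discrete driven interface model
`du_i/dt = (u_{i-1} + u_{i+1} - 2 u_i - g_i(u_i) + F)⁺` started at `0`, the
discrete Laplacian plus driving force `H_i(t) = u_{i-1}(t) + u_{i+1}(t) - 2 u_i(t) + F`
is nonnegative for all times. -/
theorem stmt5 (F : ℝ) (hF : 0 ≤ F)
    (g : ℤ → ℝ → ℝ)
    (hgpos : ∀ i y, 0 ≤ g i y)
    (hgloc : ∀ (i : ℤ) (R : ℝ), ∃ C : ℝ, ∀ y : ℝ, |y| ≤ R → g i y ≤ C)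
    (u : ℤ → ℝ → ℝ)
    (hu0 : ∀ i, u i 0 = 0)
    (hode : ∀ i : ℤ, ∀ t : ℝ, 0 ≤ t → HasDerivWithinAt (u i)
      (max (u (i - 1) t + u (i + 1) t - 2 * u i t - g i (u i t) + F) 0) (Set.Ici 0) t) :
    ∀ i : ℤ, ∀ t : ℝ, 0 ≤ t → 0 ≤ u (i - 1) t + u (i + 1) t - 2 * u i t + F := by
  intro i t ht
  refine nonneg_of_deriv_nonneg_of_neg
    (f := fun t => u (i - 1) t + u (i + 1) t - 2 * u i t + F) (by simpa [hu0] using hF)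
    (fun s hs => (((hode (i - 1) s hs).add (hode (i + 1) s hs)).sub
      ((hode i s hs).const_mul 2)).add_const F) (fun s _ hneg => ?_) ht
  rw [max_eq_right (a := u (i - 1) s + u (i + 1) s - 2 * u i s - g i (u i s) + F)
    (by linarith [hgpos i (u i s)]), mul_zero, sub_zero]
  exact add_nonneg (le_max_right _ _) (le_max_right _ _)
end

section
/- Let F ≥ 0 and let g_i : ℝ → [0,∞), i ∈ ℤ, be nonnegative locally bounded functions. Let u_i : [0,∞) → ℝ, i ∈ ℤ, be differentiable functions with u_i(0) = 0 solving du_i/dt = ( u_{i−1}(t) + u_{i+1}(t) − 2u_i(t) − g_i(u_i(t)) + F )⁺ for all t ≥ 0, and assume that sup_{i∈ℤ, 0≤s≤t} u_i(s) < ∞ for every t ≥ 0. Then 0 ≤ u_i(t) ≤ F·t for all i ∈ ℤ and t ≥ 0. -/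
open Set

/-- Integrating-factor estimate: if `x 0 = 0`, `x t ≤ K + F * t` and
`x' ≤ 2 * (K + F * t - x) + F` on `[0, T]`, then the constant `K` improves by the factor
`1 - exp (-2 * T)`. -/
lemma le_contracted_bound_of_deriv_le {F K T : ℝ} (hK : 0 ≤ K) {x x' : ℝ → ℝ} (hx0 : x 0 = 0)
    (hx : ∀ t, 0 ≤ t → HasDerivWithinAt x (x' t) (Ici 0) t)
    (hx' : ∀ t ∈ Icc 0 T, x' t ≤ 2 * (K + F * t - x t) + F) :
    ∀ t ∈ Icc 0 T, x t ≤ K * (1 - Real.exp (-2 * T)) + F * t := by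
  have hd : ∀ t, 0 ≤ t → HasDerivWithinAt (fun t => Real.exp (2 * t) * (K + F * t - x t))
      (Real.exp (2 * t) * (2 * (K + F * t - x t) + F - x' t)) (Ici 0) t := by
    intro t ht
    have he : HasDerivAt (fun t : ℝ => Real.exp (2 * t)) (Real.exp (2 * t) * (2 * 1)) t :=
      ((hasDerivAt_id t).const_mul 2).exp
    have hl : HasDerivAt (fun t : ℝ => K + F * t) (F * 1) t :=
      ((hasDerivAt_id t).const_mul F).const_add K
    exact (he.hasDerivWithinAt.mul (hl.hasDerivWithinAt.sub (hx t ht))).congr_deriv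
      (by simp only [Pi.sub_apply]; ring)
  have hmono : MonotoneOn (fun t => Real.exp (2 * t) * (K + F * t - x t)) (Icc 0 T) := by
    refine monotoneOn_of_hasDerivWithinAt_nonneg (convex_Icc 0 T)
      (fun t ht => ((hd t ht.1).continuousWithinAt).mono Icc_subset_Ici_self)
      (fun t ht => (hd t (interior_subset ht).1).mono
        (interior_subset.trans Icc_subset_Ici_self)) ?_
    intro t ht
    have := hx' t (interior_subset ht)
    exact mul_nonneg (Real.exp_pos _).le (by linarith)
  intro t ht
  have h0 : K ≤ Real.exp (2 * t) * (K + F * t - x t) := by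
    simpa [hx0] using hmono ⟨le_rfl, ht.1.trans ht.2⟩ ht ht.1
  have h1 : K * Real.exp (-2 * t) ≤ K + F * t - x t := by
    rw [neg_mul, Real.exp_neg, ← div_eq_mul_inv, div_le_iff₀ (Real.exp_pos _)]
    linarith
  have h2 : K * Real.exp (-2 * T) ≤ K * Real.exp (-2 * t) :=
    mul_le_mul_of_nonneg_left (Real.exp_le_exp.2 (by linarith [ht.2])) hK
  linarith

/-- for the discrete driven interface model
`du_i/dt = (u_{i-1} + u_{i+1} - 2 u_i - g_i(u_i) + F)⁺` started at `0`, if the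
heights are bounded on bounded time intervals (uniformly in `i`), then
`0 ≤ u_i(t) ≤ F·t` for all `i` and `t ≥ 0`. -/
theorem stmt6 (F : ℝ) (hF : 0 ≤ F)
    (g : ℤ → ℝ → ℝ)
    (hgpos : ∀ i y, 0 ≤ g i y)
    (hgloc : ∀ (i : ℤ) (R : ℝ), ∃ C : ℝ, ∀ y : ℝ, |y| ≤ R → g i y ≤ C)
    (u : ℤ → ℝ → ℝ)
    (hu0 : ∀ i, u i 0 = 0)
    (hode : ∀ i : ℤ, ∀ t : ℝ, 0 ≤ t → HasDerivWithinAt (u i)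
      (max (u (i - 1) t + u (i + 1) t - 2 * u i t - g i (u i t) + F) 0) (Set.Ici 0) t)
    (hsup : ∀ t : ℝ, 0 ≤ t → ∃ M : ℝ, ∀ i : ℤ, ∀ s ∈ Set.Icc (0 : ℝ) t, u i s ≤ M) :
    ∀ i : ℤ, ∀ t : ℝ, 0 ≤ t → 0 ≤ u i t ∧ u i t ≤ F * t := by
  have hnonneg : ∀ i : ℤ, ∀ t : ℝ, 0 ≤ t → 0 ≤ u i t := by
    intro i t ht
    have hmono : MonotoneOn (u i) (Ici 0) :=
      monotoneOn_of_hasDerivWithinAt_nonneg (convex_Ici 0)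
        (fun s hs => (hode i s hs).continuousWithinAt)
        (fun s hs => (hode i s (interior_subset hs)).mono interior_subset)
        (fun s _ => le_max_right _ _)
    simpa [hu0 i] using hmono self_mem_Ici ht ht
  intro i T hT
  refine ⟨hnonneg i T hT, ?_⟩
  obtain ⟨M, hM⟩ := hsup T hT
  set q : ℝ := 1 - Real.exp (-2 * T)
  have hq0 : 0 ≤ q := sub_nonneg.2 (Real.exp_le_one_iff.2 (by linarith))
  have hq1 : q < 1 := sub_lt_self 1 (Real.exp_pos _)
  have hiter : ∀ n : ℕ, ∀ j : ℤ, ∀ t ∈ Icc 0 T, u j t ≤ max M 0 * q ^ n + F * t := by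
    intro n
    induction n with
    | zero =>
      intro j t ht
      have := hM j t ht
      have := le_max_left M 0
      have := mul_nonneg hF ht.1
      simp only [pow_zero, mul_one]
      linarith
    | succ n ih =>
      intro j
      rw [pow_succ, ← mul_assoc]
      refine le_contracted_bound_of_deriv_le (mul_nonneg (le_max_right M 0) (pow_nonneg hq0 n))
        (hu0 j) (hode j) fun t ht => max_le ?_ ?_
      · linarith [ih (j - 1) t ht, ih (j + 1) t ht, hgpos j (u j t)]
      · linarith [ih j t ht]
  have hlim : Filter.Tendsto (fun n : ℕ => max M 0 * q ^ n + F * T) Filter.atTop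
      (nhds (F * T)) := by
    simpa using ((tendsto_pow_atTop_nhds_zero_of_lt_one hq0 hq1).const_mul (max M 0)).add_const
      (F * T)
  exact ge_of_tendsto' hlim fun n => hiter n i T ⟨hT, le_rfl⟩
end

section
/- Let F > 0, Γ > 0, t > 0, let n ∈ ℕ with n + 1 > 2F/Γ, and set γ := Γ/n. Suppose u : ℤ → ℝ satisfies 0 ≤ u_j ≤ F·t for all j ∈ ℤ and u_{i−1} + u_{i+1} − 2u_i ≥ −γ·t for all i ∈ ℤ. Then |u_{i+1} − u_i| < Γ·t for all i ∈ ℤ. -/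
/-- If the second differences of `u` are at least `-c`, then its first differences drop by at most
`c` per step. -/
theorem sub_mul_le_diff_of_neg_le_secondDiff {u : ℤ → ℝ} {c : ℝ}
    (h : ∀ i : ℤ, -c ≤ u (i - 1) + u (i + 1) - 2 * u i) (i : ℤ) (k : ℕ) :
    u (i + 1) - u i - k * c ≤ u (i + k + 1) - u (i + k) := by
  induction k with
  | zero => simp
  | succ k ih =>
    have hk := h (i + k + 1)
    rw [add_sub_cancel_right] at hk
    push_cast
    rw [← add_assoc i]
    linarith

/-- If the second differences of `u` are at least `-c`, then `u` lies above the parabola with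
second difference `-c` that agrees with `u` at `i` and `i + 1`. -/
theorem parabola_le_of_neg_le_secondDiff {u : ℤ → ℝ} {c : ℝ}
    (h : ∀ i : ℤ, -c ≤ u (i - 1) + u (i + 1) - 2 * u i) (i : ℤ) (k : ℕ) :
    k * (u (i + 1) - u i) - c * (k * (k - 1) / 2) ≤ u (i + k) - u i := by
  induction k with
  | zero => simp
  | succ k ih =>
    have hk := sub_mul_le_diff_of_neg_le_secondDiff h i k
    push_cast
    rw [← add_assoc i]
    linarith

/-- A sequence with oscillation at most `B` whose second differences are at least `-(G / n)` has
first differences less than `G`, provided `2 * B < (n + 1) * G`. -/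
theorem diff_lt_of_neg_le_secondDiff {u : ℤ → ℝ} {B G : ℝ} {n : ℕ} (hn : n ≠ 0)
    (hB : 2 * B < (n + 1) * G) (hu : ∀ i j : ℤ, u j - u i ≤ B)
    (h : ∀ i : ℤ, -(G / n) ≤ u (i - 1) + u (i + 1) - 2 * u i) (i : ℤ) :
    u (i + 1) - u i < G := by
  by_contra! hG
  have hpar := parabola_le_of_neg_le_secondDiff h i (n + 1)
  have hosc := hu i (i + (n + 1 : ℕ))
  have hn' : (n : ℝ) ≠ 0 := Nat.cast_ne_zero.mpr hn
  have hsum : G / n * (((n + 1 : ℕ) : ℝ) * ((n + 1 : ℕ) - 1) / 2) = (n + 1) * G / 2 := by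
    push_cast
    field_simp
    ring
  have hmul : ((n : ℝ) + 1) * G ≤ (n + 1) * (u (i + 1) - u i) := by gcongr
  rw [hsum] at hpar
  push_cast at hpar hosc
  linarith

/-- the deterministic combinatorial step showing that a bi-infinite
sequence confined to `[0, F*t]` whose discrete second differences are bounded below
by `-γ*t` has all first differences smaller than `Γ*t` in absolute value. -/
theorem stmt7 (F Γ t : ℝ) (hF : 0 < F) (hΓ : 0 < Γ) (ht : 0 < t)
    (n : ℕ) (hn : 1 ≤ n) (hn2 : 2 * F / Γ < (n : ℝ) + 1)
    (γ : ℝ) (hγ : γ = Γ / (n : ℝ))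
    (u : ℤ → ℝ)
    (hbd : ∀ j : ℤ, 0 ≤ u j ∧ u j ≤ F * t)
    (hlap : ∀ i : ℤ, -(γ * t) ≤ u (i - 1) + u (i + 1) - 2 * u i) :
    ∀ i : ℤ, |u (i + 1) - u i| < Γ * t := by
  have hn0 : n ≠ 0 := by omega
  have hB : 2 * (F * t) < (n + 1) * (Γ * t) := by
    rw [div_lt_iff₀ hΓ] at hn2
    nlinarith [mul_lt_mul_of_pos_right hn2 ht]
  have hc : Γ * t / n = γ * t := by rw [hγ]; ring
  intro i
  rw [abs_sub_lt_iff]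
  constructor
  · refine diff_lt_of_neg_le_secondDiff hn0 hB (fun i j ↦ ?_) (fun i ↦ ?_) i
    · linarith [(hbd i).1, (hbd j).2]
    · rw [hc]
      exact hlap i
  · have hrefl := diff_lt_of_neg_le_secondDiff (u := fun j ↦ u (-j)) hn0 hB
      (fun i j ↦ by linarith [(hbd (-i)).1, (hbd (-j)).2])
      (fun i ↦ by
        have hi := hlap (-i)
        rw [hc, show -(i - 1) = -i + 1 by ring, show -(i + 1) = -i - 1 by ring]
        linarith) (-(i + 1))
    simpa using hrefl
end

section
/- Let λ̄ > 0 and β̄ > 0, set p(l,m) := 1/(1−e^{−l}) + 1/(1−e^{l−m}), and define W̄(F) := sup_{μ > λ̄} (1/μ)( λ̄ F − log p(λ̄,μ) − log β̄ ) for F ≥ 0. Then: (i) W̄(F) ≥ 0 for all F ≥ 0 (interpreting the supremum as ≥ 0 since the expression tends to 0 as μ → ∞); (ii) W̄(F) > 0 whenever F > (1/λ̄) ( log β̄ + log( 1 + (1 − e^{−λ̄})^{−1} ) ). -/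
/-- The function `p(l,m) = 1/(1-e^{-l}) + 1/(1-e^{l-m})`. -/
noncomputable def pfun (l m : ℝ) : ℝ :=
  1 / (1 - Real.exp (-l)) + 1 / (1 - Real.exp (l - m))

/-- The lower-bound velocity `W̄(F) = sup_{μ > λ̄} (1/μ)(λ̄ F - log p(λ̄,μ) - log β̄)`. -/
noncomputable def Wbar (lam bet F : ℝ) : ℝ :=
  sSup {x : ℝ | ∃ μ > lam, x = (1 / μ) * (lam * F - Real.log (pfun lam μ) - Real.log bet)}

open Filter Topology

theorem one_le_pfun {l m : ℝ} (hl : 0 < l) (hm : l < m) : 1 ≤ pfun l m := by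
  have h₁ : 0 < 1 - Real.exp (-l) := by
    have : Real.exp (-l) < 1 := Real.exp_zero ▸ Real.exp_lt_exp.mpr (by linarith)
    linarith
  have h₂ : 0 < 1 - Real.exp (l - m) := by
    have : Real.exp (l - m) < 1 := Real.exp_zero ▸ Real.exp_lt_exp.mpr (by linarith)
    linarith
  have h₃ : 1 ≤ 1 / (1 - Real.exp (-l)) := by
    rw [le_div_iff₀ h₁]
    linarith [Real.exp_pos (-l)]
  have h₄ : 0 < 1 / (1 - Real.exp (l - m)) := by positivity
  unfold pfun
  linarith

theorem tendsto_pfun_atTop (l : ℝ) :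
    Tendsto (pfun l) atTop (𝓝 (1 + (1 - Real.exp (-l))⁻¹)) := by
  have hexp : Tendsto (fun m : ℝ => Real.exp (l - m)) atTop (𝓝 0) :=
    Real.tendsto_exp_atBot.comp (tendsto_atBot_add_const_left _ l tendsto_neg_atTop_atBot)
  have h : Tendsto (fun m : ℝ => 1 / (1 - Real.exp (-l)) + 1 / (1 - Real.exp (l - m))) atTop
      (𝓝 (1 / (1 - Real.exp (-l)) + 1 / (1 - 0))) :=
    tendsto_const_nhds.add (tendsto_const_nhds.div (tendsto_const_nhds.sub hexp) (by norm_num))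
  have hval : 1 + (1 - Real.exp (-l))⁻¹ = 1 / (1 - Real.exp (-l)) + 1 / (1 - 0) := by
    simp [add_comm]
  rw [hval]
  exact h

theorem tendsto_log_pfun_atTop {l : ℝ} (hl : 0 < l) :
    Tendsto (fun m => Real.log (pfun l m)) atTop
      (𝓝 (Real.log (1 + (1 - Real.exp (-l))⁻¹))) := by
  have : Real.exp (-l) < 1 := Real.exp_zero ▸ Real.exp_lt_exp.mpr (by linarith)
  have hpos : 0 < (1 - Real.exp (-l))⁻¹ := inv_pos.mpr (by linarith)
  exact (tendsto_pfun_atTop l).log (by linarith)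

theorem le_Wbar {lam μ : ℝ} (bet F : ℝ) (hlam : 0 < lam) (hμ : lam < μ) :
    (1 / μ) * (lam * F - Real.log (pfun lam μ) - Real.log bet) ≤ Wbar lam bet F := by
  refine le_csSup ⟨(1 / lam) * (|lam * F| + |Real.log bet|), ?_⟩ ⟨μ, hμ, rfl⟩
  rintro x ⟨m, hm, rfl⟩
  have hm' : lam < m := hm
  have hlog := Real.log_nonneg (one_le_pfun hlam hm')
  have hm₀ : 0 < m := hlam.trans hm'
  calc (1 / m) * (lam * F - Real.log (pfun lam m) - Real.log bet)
      ≤ (1 / m) * (|lam * F| + |Real.log bet|) := by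
        refine mul_le_mul_of_nonneg_left ?_ (by positivity)
        linarith [le_abs_self (lam * F), neg_abs_le (Real.log bet)]
    _ ≤ (1 / lam) * (|lam * F| + |Real.log bet|) :=
        mul_le_mul_of_nonneg_right (one_div_le_one_div_of_le hlam hm'.le) (by positivity)

/-- (i) `W̄(F) ≥ 0` for all `F ≥ 0`; (ii) `W̄(F) > 0` whenever
`F > (1/λ̄)(log β̄ + log(1 + (1 - e^{-λ̄})⁻¹))`. -/
theorem stmt10 (lam bet : ℝ) (hlam : 0 < lam) (hbet : 0 < bet) :
    (∀ F : ℝ, 0 ≤ F → 0 ≤ Wbar lam bet F) ∧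
    (∀ F : ℝ, (1 / lam) * (Real.log bet + Real.log (1 + (1 - Real.exp (-lam))⁻¹)) < F →
      0 < Wbar lam bet F) := by
  have hlim : ∀ F : ℝ,
      Tendsto (fun μ => lam * F - Real.log (pfun lam μ) - Real.log bet) atTop
        (𝓝 (lam * F - Real.log (1 + (1 - Real.exp (-lam))⁻¹) - Real.log bet)) := fun F =>
    (tendsto_const_nhds.sub (tendsto_log_pfun_atTop hlam)).sub tendsto_const_nhds
  refine ⟨fun F _ => ?_, fun F hF => ?_⟩
  · have hinv : Tendsto (fun μ : ℝ => 1 / μ) atTop (𝓝 0) := by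
      simpa only [one_div] using tendsto_inv_atTop_zero (𝕜 := ℝ)
    have hzero := hinv.mul (hlim F)
    rw [zero_mul] at hzero
    refine le_of_tendsto hzero ?_
    filter_upwards [eventually_gt_atTop lam] with μ hμ
    exact le_Wbar bet F hlam hμ
  · have hpos : 0 < lam * F - Real.log (1 + (1 - Real.exp (-lam))⁻¹) - Real.log bet := by
      rw [one_div_mul_eq_div, div_lt_iff₀ hlam] at hF
      linarith
    obtain ⟨μ, hμ, hμlam⟩ :=
      (((hlim F).eventually_const_lt hpos).and (eventually_gt_atTop lam)).exists
    have hμ₀ : 0 < μ := hlam.trans hμlam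
    exact (mul_pos (one_div_pos.mpr hμ₀) hμ).trans_le (le_Wbar bet F hlam hμlam)
end

section
/- Let F ≥ 0 and let f : ℝ × ℝ → [0,∞) be a continuous nonnegative function. Let u : ℝ × [0,∞) → ℝ be a classical solution of u_t(x,t) = u_xx(x,t) − f(x, u(x,t)) + F with u(x,0) = 0, and assume u_t(x,t) ≥ 0 and 0 ≤ u(x,t) ≤ F·t for all x ∈ ℝ, t ≥ 0. Then for all x₁, x₂ ∈ ℝ, lim_{t→∞} (u(x₂,t) − u(x₁,t))/t = 0, and the convergence is uniform for x₁, x₂ ranging over any compact interval. -/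
open MeasureTheory

/-- A function with values in `[0, M]` whose second derivative is at least `-F` has first
derivative bounded by `M / h + F * h / 2`, for every `h > 0`. -/
theorem abs_deriv_le_of_neg_le_deriv2 {F M h : ℝ} (hh : 0 < h) {g g' g'' : ℝ → ℝ}
    (hg : ∀ x, HasDerivAt g (g' x) x) (hg' : ∀ x, HasDerivAt g' (g'' x) x)
    (hF : ∀ x, -F ≤ g'' x) (h0 : ∀ x, 0 ≤ g x) (hM : ∀ x, g x ≤ M) (x : ℝ) :
    |g' x| ≤ M / h + F * h / 2 := by
  have hw : ∀ y, HasDerivAt (fun z => g z + F / 2 * z ^ 2) (g' y + F * y) y := fun y => by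
    refine ((hg y).add ((hasDerivAt_pow 2 y).const_mul (F / 2))).congr_deriv ?_
    push_cast
    ring
  have hw' : ∀ y, HasDerivAt (fun z => g' z + F * z) (g'' y + F) y := fun y =>
    ((hg' y).add ((hasDerivAt_id y).const_mul F)).congr_deriv (by ring)
  have hderiv : deriv (fun z => g z + F / 2 * z ^ 2) = fun z => g' z + F * z :=
    funext fun y => (hw y).deriv
  have hconv : ConvexOn ℝ Set.univ (fun z => g z + F / 2 * z ^ 2) := by
    refine Monotone.convexOn_univ_of_deriv (fun y => (hw y).differentiableAt) ?_
    rw [hderiv]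
    refine monotone_of_deriv_nonneg (fun y => (hw' y).differentiableAt) fun y => ?_
    rw [(hw' y).deriv]
    linarith [hF y]
  have hr := hconv.le_slope_of_hasDerivAt (Set.mem_univ x) (Set.mem_univ (x + h))
    (by linarith) (hw x)
  have hl := hconv.slope_le_of_hasDerivAt (Set.mem_univ (x - h)) (Set.mem_univ x)
    (by linarith) (hw x)
  rw [slope_def_field, le_div_iff₀ (by linarith)] at hr
  rw [slope_def_field, div_le_iff₀ (by linarith)] at hl
  have hsum : M / h + F * h / 2 = (M + F * h ^ 2 / 2) / h := by
    field_simp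
  rw [hsum, le_div_iff₀ hh, ← abs_of_pos hh, ← abs_mul, abs_of_pos hh, abs_le]
  constructor
  · linarith [h0 x, hM (x - h)]
  · linarith [h0 x, hM (x + h)]

/-- for a classical solution of the driven interface equation
`u_t = u_xx - f(x,u) + F`, `u(·,0) = 0`, with continuous nonnegative obstacle
field `f`, nonnegative velocity `u_t ≥ 0` and bounds `0 ≤ u ≤ F·t`, the
differences `(u(x₂,t) - u(x₁,t))/t` tend to `0` as `t → ∞`, uniformly for
`x₁, x₂` in any compact interval. -/
theorem stmt15 (F : ℝ) (hF : 0 ≤ F)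
    (f : ℝ → ℝ → ℝ)
    (hfc : Continuous fun p : ℝ × ℝ => f p.1 p.2)
    (hfpos : ∀ x y, 0 ≤ f x y)
    (u ux uxx ut : ℝ → ℝ → ℝ)
    (hu0 : ∀ x, u x 0 = 0)
    (hux : ∀ x t : ℝ, 0 ≤ t → HasDerivAt (fun y => u y t) (ux x t) x)
    (huxx : ∀ x t : ℝ, 0 ≤ t → HasDerivAt (fun y => ux y t) (uxx x t) x)
    (hut : ∀ x t : ℝ, 0 ≤ t → HasDerivWithinAt (fun s => u x s) (ut x t) (Set.Ici 0) t)
    (heq : ∀ x t : ℝ, 0 ≤ t → ut x t = uxx x t - f x (u x t) + F)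
    (hutpos : ∀ x t : ℝ, 0 ≤ t → 0 ≤ ut x t)
    (hbd : ∀ x t : ℝ, 0 ≤ t → 0 ≤ u x t ∧ u x t ≤ F * t) :
    (∀ x₁ x₂ : ℝ, Filter.Tendsto (fun t : ℝ => (u x₂ t - u x₁ t) / t)
      Filter.atTop (nhds 0)) ∧
    (∀ a b : ℝ, ∀ ε : ℝ, 0 < ε → ∃ T : ℝ, ∀ t : ℝ, T ≤ t →
      ∀ x₁ ∈ Set.Icc a b, ∀ x₂ ∈ Set.Icc a b, |(u x₂ t - u x₁ t) / t| < ε) := by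
  have hlip : ∀ t : ℝ, 0 < t → ∀ x₁ x₂ : ℝ,
      |u x₂ t - u x₁ t| ≤ 3 / 2 * F * √t * |x₂ - x₁| := by
    intro t ht x₁ x₂
    have hderiv : ∀ x, |ux x t| ≤ 3 / 2 * F * √t := fun x => by
      have hbound := abs_deriv_le_of_neg_le_deriv2 (F := F) (M := F * t) (Real.sqrt_pos.2 ht)
        (fun y => hux y t ht.le) (fun y => huxx y t ht.le)
        (fun y => by linarith [heq y t ht.le, hutpos y t ht.le, hfpos y (u y t)])
        (fun y => (hbd y t ht.le).1) (fun y => (hbd y t ht.le).2) x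
      rw [mul_div_assoc, Real.div_sqrt] at hbound
      linarith
    exact Convex.norm_image_sub_le_of_norm_hasDerivWithin_le
      (fun x _ => (hux x t ht.le).hasDerivWithinAt) (fun x _ => hderiv x) convex_univ
      (Set.mem_univ x₁) (Set.mem_univ x₂)
  have hunif : ∀ a b : ℝ, ∀ ε : ℝ, 0 < ε → ∃ T : ℝ, ∀ t : ℝ, T ≤ t →
      ∀ x₁ ∈ Set.Icc a b, ∀ x₂ ∈ Set.Icc a b, |(u x₂ t - u x₁ t) / t| < ε := by
    intro a b ε hε
    have hlim : Filter.Tendsto (fun t : ℝ => 3 / 2 * F * (b - a) / √t) Filter.atTop (nhds 0) :=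
      Real.tendsto_sqrt_atTop.const_div_atTop _
    obtain ⟨T, hT⟩ := Filter.eventually_atTop.1
      ((hlim.eventually_lt_const hε).and (Filter.eventually_gt_atTop 0))
    refine ⟨T, fun t htT x₁ hx₁ x₂ hx₂ => ?_⟩
    obtain ⟨hsmall, ht⟩ := hT t htT
    refine lt_of_le_of_lt ?_ hsmall
    have hsqrt : 0 < √t := Real.sqrt_pos.2 ht
    have hdist : |x₂ - x₁| ≤ b - a :=
      abs_le.2 ⟨by linarith [hx₁.2, hx₂.1], by linarith [hx₁.1, hx₂.2]⟩
    rw [abs_div, abs_of_pos ht, div_le_div_iff₀ ht hsqrt]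
    calc |u x₂ t - u x₁ t| * √t ≤ 3 / 2 * F * √t * (b - a) * √t := by
          gcongr
          exact (hlip t ht x₁ x₂).trans (by gcongr)
      _ = 3 / 2 * F * (b - a) * (√t * √t) := by ring
      _ = 3 / 2 * F * (b - a) * t := by rw [Real.mul_self_sqrt ht.le]
  refine ⟨fun x₁ x₂ => Metric.tendsto_atTop.2 fun ε hε => ?_, hunif⟩
  obtain ⟨T, hT⟩ := hunif (min x₁ x₂) (max x₁ x₂) ε hε
  refine ⟨T, fun t ht => ?_⟩
  rw [Real.dist_eq, sub_zero]
  exact hT t ht x₁ ⟨min_le_left _ _, le_max_left _ _⟩ x₂ ⟨min_le_right _ _, le_max_right _ _⟩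
end
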